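/- Assume β, h > 0 satisfy the AT-line condition β² E[cosh^{−4}(βz√q + h)] ≤ 1, where q = q_{β,h} and z is standard Gaussian. Then the sequence k ↦ Δ^{∘k}(Q(β,h)) is strictly increasing and lim_{k→∞} Δ^{∘k}(Q(β,h)) = q, where Δ^{∘k} denotes k-fold composition. -/

import Mathlib

open MeasureTheory ProbabilityTheory Filter

noncomputable section

namespace CT

/-- the fixed point equation characterizing `q_{β,h}`. -/
def qEq (β h q : ℝ) : Prop :=
  q = ∫ z, (Real.tanh (β * z * Real.sqrt q + h)) ^ 2 ∂(gaussianReal 0 1)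

/-- the auxiliary function `Γ(t; γ, γ')`, with `Th(x) = tanh(x + h)`. -/
def Gam (β h : ℝ) (t γ γ' : ℝ) : ℝ :=
  ∫ z, ∫ z1, ∫ z2,
      Real.tanh (β * z * Real.sqrt (γ * |t|) + β * z1 * Real.sqrt (γ * (1 - |t|)) + h)
        * Real.tanh (β * Real.sign t * z * Real.sqrt (γ' * |t|)
            + β * z2 * Real.sqrt (γ' * (1 - |t|)) + h)
      ∂(gaussianReal 0 1) ∂(gaussianReal 0 1) ∂(gaussianReal 0 1)

/-- `Δ(t) = Γ(t/q; q, q)`. -/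
def Del (β h q : ℝ) (t : ℝ) : ℝ := Gam β h (t / q) q q

/-- `Q(β,h) = √q ⬝ E Th(βz√q)`. -/
def Qbh (β h q : ℝ) : ℝ :=
  Real.sqrt q * ∫ z, Real.tanh (β * z * Real.sqrt q + h) ∂(gaussianReal 0 1)

local notation "γ₁" => gaussianReal 0 1
local notation "γ₂" => Measure.prod γ₁ γ₁

section Gaussian

variable {f f' : ℝ → ℝ} {A B : ℝ}

/-- A standard Gaussian vector of the plane is invariant under rotations. -/
lemma integral_gaussian_rotation (θ : ℝ) (F : ℝ → ℝ → ℝ) :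
    ∫ p : ℝ × ℝ, F (Real.cos θ * p.1 + Real.sin θ * p.2)
        (-Real.sin θ * p.1 + Real.cos θ * p.2) ∂γ₂
      = ∫ p : ℝ × ℝ, F p.1 p.2 ∂γ₂ := by
  have hmap := IsGaussian.map_rotation_eq_self (μ := γ₁) (by simp) θ
  have hinj : Function.Injective
      (ContinuousLinearMap.rotation θ : ℝ × ℝ → ℝ × ℝ) := by
    rintro ⟨x, y⟩ ⟨x', y'⟩ h
    simp only [ContinuousLinearMap.rotation_apply, smul_eq_mul, Prod.mk.injEq] at h
    obtain ⟨h1, h2⟩ := h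
    have h3 := Real.sin_sq_add_cos_sq θ
    ext
    · linear_combination Real.cos θ * h1 - Real.sin θ * h2 + (x' - x) * h3
    · linear_combination Real.sin θ * h1 + Real.cos θ * h2 + (y' - y) * h3
  have hmp : MeasurePreserving (ContinuousLinearMap.rotation θ : ℝ × ℝ → ℝ × ℝ)
      γ₂ γ₂ :=
    ⟨(ContinuousLinearMap.rotation θ).continuous.measurable, hmap⟩
  exact hmp.integral_comp
    ((ContinuousLinearMap.rotation θ).continuous.measurableEmbedding hinj) (fun p => F p.1 p.2)

/-- Gaussian integration by parts. -/
lemma integral_id_mul_gaussian (hf : ∀ x, HasDerivAt f (f' x) x) (hf' : Continuous f')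
    (hA : ∀ x, |f x| ≤ A) (hB : ∀ x, |f' x| ≤ B) :
    ∫ x, x * f x ∂γ₁ = ∫ x, f' x ∂γ₁ := by
  have hfc : Continuous f := continuous_iff_continuousAt.2 fun x => (hf x).continuousAt
  have hpdf : ∀ x, gaussianPDFReal 0 1 x = (√(2 * Real.pi))⁻¹ * Real.exp (-(1 / 2) * x ^ 2) := by
    intro x
    simp only [gaussianPDFReal, NNReal.coe_one, mul_one, sub_zero]
    congr 2
    ring
  have hderiv : ∀ x, HasDerivAt (gaussianPDFReal 0 1) (-(x * gaussianPDFReal 0 1 x)) x := by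
    intro x
    rw [funext hpdf]
    have h := (((hasDerivAt_id x).pow 2).const_mul (-(1 / 2 : ℝ))).exp.const_mul
      (√(2 * Real.pi))⁻¹
    refine h.congr_deriv ?_
    simp
    ring
  have hI0 : Integrable (gaussianPDFReal 0 1) := integrable_gaussianPDFReal 0 1
  have hI1 : Integrable (fun x => -(x * gaussianPDFReal 0 1 x)) := by
    have h := ((integrable_mul_exp_neg_mul_sq (by norm_num : (0 : ℝ) < 1 / 2)).const_mul
      (√(2 * Real.pi))⁻¹).neg
    refine h.congr (ae_of_all _ fun x => ?_)
    simp only [hpdf, Pi.neg_apply]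
    ring
  have key := integral_mul_deriv_eq_deriv_mul_of_integrable (u := f) (v := gaussianPDFReal 0 1)
    (fun x _ => hf x) (fun x _ => hderiv x)
    (hI1.bdd_mul hfc.aestronglyMeasurable (ae_of_all _ hA))
    (hI0.bdd_mul hf'.aestronglyMeasurable (ae_of_all _ hB))
    (hI0.bdd_mul hfc.aestronglyMeasurable (ae_of_all _ hA))
  rw [integral_gaussianReal_eq_integral_smul one_ne_zero,
    integral_gaussianReal_eq_integral_smul one_ne_zero, ← neg_inj, ← integral_neg]
  simp only [smul_eq_mul]
  convert key using 1
  · exact integral_congr_ae (ae_of_all _ fun x => by ring)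
  · exact congrArg _ (integral_congr_ae (ae_of_all _ fun x => by ring))

lemma integrable_of_continuous_of_bound {X : Type*} [TopologicalSpace X] [MeasurableSpace X]
    [OpensMeasurableSpace X] {μ : Measure X} [IsFiniteMeasure μ] {g : X → ℝ} {C : ℝ}
    (hg : Continuous g) (hC : ∀ x, |g x| ≤ C) : Integrable g μ :=
  .of_bound hg.measurable.aestronglyMeasurable C (ae_of_all _ hC)

lemma abs_mul_le_of_abs_le {a b : ℝ} (ha : |a| ≤ A) (hb : |b| ≤ B) : |a * b| ≤ A * B := by
  rw [abs_mul]
  exact mul_le_mul ha hb (abs_nonneg _) ((abs_nonneg _).trans ha)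

/-- The covariance `E[f(X) f(Y)]` of two standard Gaussian variables of correlation `cos θ`. -/
def rotCov (f : ℝ → ℝ) (θ : ℝ) : ℝ :=
  ∫ p : ℝ × ℝ, f p.1 * f (Real.cos θ * p.1 + Real.sin θ * p.2) ∂γ₂

lemma rotCov_zero (f : ℝ → ℝ) : rotCov f 0 = ∫ x, f x ^ 2 ∂γ₁ := by
  have h := integral_fun_fst (μ := γ₁) (ν := γ₁) (fun x => f x ^ 2)
  simp only [probReal_univ, one_smul] at h
  rw [← h]
  simp [rotCov, sq]

lemma rotCov_pi_div_two (f : ℝ → ℝ) : rotCov f (Real.pi / 2) = (∫ x, f x ∂γ₁) ^ 2 := by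
  simp only [rotCov, Real.cos_pi_div_two, Real.sin_pi_div_two, zero_mul, one_mul, zero_add]
  rw [integral_prod_mul f f, sq]

lemma hasDerivAt_rotCov (hf : ∀ x, HasDerivAt f (f' x) x) (hf' : Continuous f')
    (hA : ∀ x, |f x| ≤ A) (hB : ∀ x, |f' x| ≤ B) (θ : ℝ) :
    HasDerivAt (rotCov f) (-Real.sin θ * rotCov f' θ) θ := by
  have hfc : Continuous f := continuous_iff_continuousAt.2 fun x => (hf x).continuousAt
  have hid : Integrable (fun x : ℝ => x) γ₁ :=
    memLp_one_iff_integrable.1 (memLp_id_gaussianReal 1)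
  have habs : Integrable (fun p : ℝ × ℝ => A * B * (|p.1| + |p.2|)) γ₂ :=
    ((hid.abs.comp_fst γ₁).add (hid.abs.comp_snd γ₁)).const_mul _
  have hA0 : 0 ≤ A := (abs_nonneg _).trans (hA 0)
  have hB0 : 0 ≤ B := (abs_nonneg _).trans (hB 0)
  have hD := (hasDerivAt_integral_of_dominated_loc_of_deriv_le (μ := γ₂)
    (F := fun (t : ℝ) (p : ℝ × ℝ) => f p.1 * f (Real.cos t * p.1 + Real.sin t * p.2))
    (F' := fun (t : ℝ) (p : ℝ × ℝ) => f p.1 * (f' (Real.cos t * p.1 + Real.sin t * p.2)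
      * (-Real.sin t * p.1 + Real.cos t * p.2)))
    (bound := fun p : ℝ × ℝ => A * B * (|p.1| + |p.2|)) (x₀ := θ) (s := Set.univ)
    Filter.univ_mem
    (Eventually.of_forall fun t => Continuous.aestronglyMeasurable (by fun_prop))
    (integrable_of_continuous_of_bound (by fun_prop) fun p => abs_mul_le_of_abs_le (hA _) (hA _))
    (Continuous.aestronglyMeasurable (by fun_prop))
    (ae_of_all _ fun p t _ => ?_) habs (ae_of_all _ fun p t _ => ?_)).2
  · refine hD.congr_deriv ?_
    calc ∫ p : ℝ × ℝ, f p.1 * (f' (Real.cos θ * p.1 + Real.sin θ * p.2)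
            * (-Real.sin θ * p.1 + Real.cos θ * p.2)) ∂γ₂
        = ∫ p : ℝ × ℝ, f (Real.cos θ * p.1 - Real.sin θ * p.2) * (f' p.1 * p.2)
            ∂γ₂ := by
          rw [← integral_gaussian_rotation θ
            (fun u v => f (Real.cos θ * u - Real.sin θ * v) * (f' u * v))]
          refine integral_congr_ae (ae_of_all _ fun p => ?_)
          have : Real.cos θ * (Real.cos θ * p.1 + Real.sin θ * p.2)
              - Real.sin θ * (-Real.sin θ * p.1 + Real.cos θ * p.2) = p.1 := by
            linear_combination p.1 * Real.sin_sq_add_cos_sq θ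
          simp only [this]
      _ = ∫ u, ∫ v, f (Real.cos θ * u - Real.sin θ * v) * (f' u * v) ∂γ₁ ∂γ₁ := by
          refine integral_prod _ (habs.mono' (Continuous.aestronglyMeasurable (by fun_prop))
            (ae_of_all _ fun p => ?_))
          rw [Real.norm_eq_abs, ← mul_assoc, abs_mul]
          exact mul_le_mul (abs_mul_le_of_abs_le (hA _) (hB _))
            (le_add_of_nonneg_left (abs_nonneg _)) (abs_nonneg _) (by positivity)
      _ = ∫ u, ∫ v, -Real.sin θ * (f' (Real.cos θ * u - Real.sin θ * v) * f' u) ∂γ₁ ∂γ₁ := by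
          refine integral_congr_ae (ae_of_all _ fun u => ?_)
          have hg : ∀ v, HasDerivAt (fun v => f (Real.cos θ * u - Real.sin θ * v) * f' u)
              (-Real.sin θ * (f' (Real.cos θ * u - Real.sin θ * v) * f' u)) v := by
            intro v
            have h1 : HasDerivAt (fun v => Real.cos θ * u - Real.sin θ * v) (-Real.sin θ) v := by
              simpa using ((hasDerivAt_id v).const_mul (Real.sin θ)).const_sub (Real.cos θ * u)
            refine (((hf _).comp v h1).mul_const (f' u)).congr_deriv ?_
            ring
          beta_reduce
          rw [← integral_id_mul_gaussian hg (by fun_prop)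
            (fun v => abs_mul_le_of_abs_le (hA _) (hB _))
            (fun v => abs_mul_le_of_abs_le (le_refl |-Real.sin θ|)
              (abs_mul_le_of_abs_le (hB _) (hB _)))]
          exact integral_congr_ae (ae_of_all _ fun v => by ring)
      _ = ∫ p : ℝ × ℝ, -Real.sin θ * (f' (Real.cos θ * p.1 - Real.sin θ * p.2) * f' p.1)
            ∂γ₂ := by
          exact (integral_prod (fun p : ℝ × ℝ =>
              -Real.sin θ * (f' (Real.cos θ * p.1 - Real.sin θ * p.2) * f' p.1))
            (integrable_of_continuous_of_bound (by fun_prop) fun p =>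
              abs_mul_le_of_abs_le (le_refl |-Real.sin θ|)
                (abs_mul_le_of_abs_le (hB _) (hB _)))).symm
      _ = -Real.sin θ * rotCov f' θ := by
          rw [integral_const_mul, rotCov, ← integral_gaussian_rotation θ
            (fun u v => f' (Real.cos θ * u - Real.sin θ * v) * f' u)]
          congr 1
          refine integral_congr_ae (ae_of_all _ fun p => ?_)
          have : Real.cos θ * (Real.cos θ * p.1 + Real.sin θ * p.2)
              - Real.sin θ * (-Real.sin θ * p.1 + Real.cos θ * p.2) = p.1 := by
            linear_combination p.1 * Real.sin_sq_add_cos_sq θ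
          simp only [this]
  · rw [Real.norm_eq_abs, ← mul_assoc, abs_mul]
    refine mul_le_mul (abs_mul_le_of_abs_le (hA _) (hB _)) ((abs_add_le _ _).trans ?_)
      (abs_nonneg _) (by positivity)
    rw [abs_mul, abs_mul, abs_neg]
    exact add_le_add (mul_le_of_le_one_left (abs_nonneg _) (Real.abs_sin_le_one _))
      (mul_le_of_le_one_left (abs_nonneg _) (Real.abs_cos_le_one _))
  · have h1 : HasDerivAt (fun t => Real.cos t * p.1 + Real.sin t * p.2)
        (-Real.sin t * p.1 + Real.cos t * p.2) t :=
      ((Real.hasDerivAt_cos t).mul_const _).add ((Real.hasDerivAt_sin t).mul_const _)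
    exact ((hf _).comp t h1).const_mul _

lemma rotCov_lt (hf : Continuous f) (hA : ∀ x, |f x| ≤ A) {y θ : ℝ} (hy : f 0 ≠ f y)
    (hθ : Real.sin θ ≠ 0) : rotCov f θ < ∫ x, f x ^ 2 ∂γ₁ := by
  have : Measure.IsOpenPosMeasure γ₁ :=
    (gaussianReal_absolutelyContinuous' 0 one_ne_zero).isOpenPosMeasure
  set Y : ℝ × ℝ → ℝ := fun p => Real.cos θ * p.1 + Real.sin θ * p.2 with hY
  have hYc : Continuous Y := by fun_prop
  have hI {g : ℝ × ℝ → ℝ} (hg : Continuous g) {C : ℝ} (hC : ∀ p, |g p| ≤ C) :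
      Integrable g γ₂ := integrable_of_continuous_of_bound hg hC
  have hXX : Integrable (fun p : ℝ × ℝ => f p.1 ^ 2) γ₂ :=
    hI (by fun_prop) fun p => by rw [sq]; exact abs_mul_le_of_abs_le (hA _) (hA _)
  have hYY : Integrable (fun p : ℝ × ℝ => f (Y p) ^ 2) γ₂ :=
    hI (by fun_prop) fun p => by rw [sq]; exact abs_mul_le_of_abs_le (hA _) (hA _)
  have hXY : Integrable (fun p : ℝ × ℝ => f p.1 * f (Y p)) γ₂ :=
    hI (by fun_prop) fun p => abs_mul_le_of_abs_le (hA _) (hA _)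
  have hEX : ∫ p : ℝ × ℝ, f p.1 ^ 2 ∂γ₂ = ∫ x, f x ^ 2 ∂γ₁ := by
    simpa using integral_fun_fst (μ := γ₁) (ν := γ₁) (fun x => f x ^ 2)
  have hEY : ∫ p : ℝ × ℝ, f (Y p) ^ 2 ∂γ₂ = ∫ x, f x ^ 2 ∂γ₁ := by
    rw [← hEX]
    exact integral_gaussian_rotation θ (fun u _ => f u ^ 2)
  have hexp : ∀ p : ℝ × ℝ, (f p.1 - f (Y p)) ^ 2
      = f p.1 ^ 2 + f (Y p) ^ 2 - 2 * (f p.1 * f (Y p)) := fun p => by ring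
  have hdiff : Integrable (fun p : ℝ × ℝ => (f p.1 - f (Y p)) ^ 2) γ₂ := by
    simp only [hexp]
    exact (hXX.add hYY).sub (hXY.const_mul 2)
  have hpos : 0 < ∫ p : ℝ × ℝ, (f p.1 - f (Y p)) ^ 2 ∂γ₂ := by
    refine integral_pos_of_integrable_nonneg_nonzero (x := (0, y / Real.sin θ)) (by fun_prop)
      hdiff (fun p => sq_nonneg _) ?_
    have : Y (0, y / Real.sin θ) = y := by simp [hY, mul_div_cancel₀ _ hθ]
    simpa [this, sub_eq_zero] using hy
  have hadd : Integrable (fun p : ℝ × ℝ => f p.1 ^ 2 + f (Y p) ^ 2) γ₂ := hXX.add hYY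
  simp only [hexp] at hpos
  rw [integral_sub hadd (hXY.const_mul 2), integral_add hXX hYY, integral_const_mul,
    hEX, hEY] at hpos
  have : rotCov f θ = ∫ p : ℝ × ℝ, f p.1 * f (Y p) ∂γ₂ := rfl
  linarith

/-- Two Gaussian variables sharing a common component of variance `s` have correlation `s`. -/
lemma integral_shared_gaussian (hf : Continuous f) (hA : ∀ x, |f x| ≤ A) {s : ℝ} (hs : 0 ≤ s)
    (hs1 : s ≤ 1) :
    ∫ z, ∫ z1, ∫ z2, f (√s * z + √(1 - s) * z1) * f (√s * z + √(1 - s) * z2) ∂γ₁ ∂γ₁ ∂γ₁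
      = rotCov f (Real.arccos s) := by
  have ha : √s ^ 2 = s := Real.sq_sqrt hs
  have hb : √(1 - s) ^ 2 = 1 - s := Real.sq_sqrt (by linarith)
  have hr : √(1 + s) ^ 2 = 1 + s := Real.sq_sqrt (by linarith)
  have hr0 : √(1 + s) ≠ 0 := (Real.sqrt_pos.2 (by linarith)).ne'
  have hcosθ : Real.cos (Real.arccos s) = s := Real.cos_arccos (by linarith) hs1
  have hsinθ : Real.sin (Real.arccos s) = √(1 - s) * √(1 + s) := by
    rw [Real.sin_arccos, ← Real.sqrt_mul (by linarith)]
    ring_nf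
  set a := √s with ha_def
  set b := √(1 - s) with hb_def
  set r := √(1 + s) with hr_def
  have ha0 : 0 ≤ a := Real.sqrt_nonneg _
  have ha1 : a ≤ 1 := Real.sqrt_le_one.2 hs1
  have hcosα : Real.cos (Real.arccos a) = a := Real.cos_arccos (by linarith) ha1
  have hsinα : Real.sin (Real.arccos a) = b := by rw [Real.sin_arccos, ha]
  have hcosδ : Real.cos (Real.arctan a) = 1 / r := by rw [Real.cos_arctan, ha]
  have hsinδ : Real.sin (Real.arctan a) = a / r := by rw [Real.sin_arctan, ha]
  calc ∫ z, ∫ z1, ∫ z2, f (a * z + b * z1) * f (a * z + b * z2) ∂γ₁ ∂γ₁ ∂γ₁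
      = ∫ p : ℝ × ℝ, ∫ w, f (a * p.1 + b * p.2) * f (a * p.1 + b * w) ∂γ₁ ∂γ₂ := by
        refine (integral_prod (fun p : ℝ × ℝ => ∫ w, f (a * p.1 + b * p.2)
          * f (a * p.1 + b * w) ∂γ₁) ?_).symm
        exact (integrable_of_continuous_of_bound (μ := Measure.prod γ₂ γ₁)
          (g := fun x : (ℝ × ℝ) × ℝ => f (a * x.1.1 + b * x.1.2) * f (a * x.1.1 + b * x.2))
          (by fun_prop) fun x => abs_mul_le_of_abs_le (hA _) (hA _)).integral_prod_left
    _ = ∫ p : ℝ × ℝ, ∫ w, f p.1 * f (a * (a * p.1 - b * p.2) + b * w) ∂γ₁ ∂γ₂ := by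
        rw [← integral_gaussian_rotation (Real.arccos a)
          (fun x v => ∫ w, f x * f (a * (a * x - b * v) + b * w) ∂γ₁), hcosα, hsinα]
        refine integral_congr_ae (ae_of_all _ fun p => ?_)
        have : a * (a * p.1 + b * p.2) - b * (-b * p.1 + a * p.2) = p.1 := by
          linear_combination p.1 * (ha + hb)
        simp only [this]
    _ = ∫ x, ∫ v, ∫ w, f x * f (a * (a * x - b * v) + b * w) ∂γ₁ ∂γ₁ ∂γ₁ := by
        refine integral_prod _ ?_
        exact (integrable_of_continuous_of_bound (μ := Measure.prod γ₂ γ₁)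
          (g := fun x : (ℝ × ℝ) × ℝ => f x.1.1 * f (a * (a * x.1.1 - b * x.1.2) + b * x.2))
          (by fun_prop) fun x => abs_mul_le_of_abs_le (hA _) (hA _)).integral_prod_left
    _ = ∫ x, ∫ w, f x * f (s * x + b * r * w) ∂γ₁ ∂γ₁ := by
        refine integral_congr_ae (ae_of_all _ fun x => ?_)
        calc ∫ v, ∫ w, f x * f (a * (a * x - b * v) + b * w) ∂γ₁ ∂γ₁
            = ∫ p : ℝ × ℝ, f x * f (a * (a * x - b * p.1) + b * p.2) ∂γ₂ :=
              (integral_prod (fun p : ℝ × ℝ => f x * f (a * (a * x - b * p.1) + b * p.2))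
                (integrable_of_continuous_of_bound (by fun_prop) fun p =>
                  abs_mul_le_of_abs_le (hA _) (hA _))).symm
          _ = ∫ p : ℝ × ℝ, f x * f (s * x + b * r * p.2) ∂γ₂ := by
              rw [← integral_gaussian_rotation (Real.arctan a)
                (fun _ w => f x * f (s * x + b * r * w)), hcosδ, hsinδ]
              refine integral_congr_ae (ae_of_all _ fun p => ?_)
              have : s * x + b * r * (-(a / r) * p.1 + 1 / r * p.2)
                  = a * (a * x - b * p.1) + b * p.2 := by
                field_simp
                linear_combination -x * ha
              simp only [this]
          _ = ∫ w, f x * f (s * x + b * r * w) ∂γ₁ := by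
              simpa using integral_fun_snd (μ := γ₁) (ν := γ₁)
                (fun w => f x * f (s * x + b * r * w))
    _ = rotCov f (Real.arccos s) := by
        rw [rotCov, hcosθ, hsinθ]
        exact (integral_prod (fun p : ℝ × ℝ => f p.1 * f (s * p.1 + b * r * p.2))
          (integrable_of_continuous_of_bound (by fun_prop) fun p =>
            abs_mul_le_of_abs_le (hA _) (hA _))).symm

/-- If `E[f'(X)²] ≤ E[f(X)²]`, the covariance of `f` at correlation `cos θ` exceeds
`cos θ * E[f(X)²]`. -/
lemma cos_mul_lt_rotCov (hf : ∀ x, HasDerivAt f (f' x) x) (hf' : Continuous f')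
    (hA : ∀ x, |f x| ≤ A) (hB : ∀ x, |f' x| ≤ B) {y : ℝ} (hy : f' 0 ≠ f' y)
    (hle : ∫ x, f' x ^ 2 ∂γ₁ ≤ ∫ x, f x ^ 2 ∂γ₁) {θ : ℝ} (hθ : 0 < θ) (hθ' : θ < Real.pi) :
    Real.cos θ * ∫ x, f x ^ 2 ∂γ₁ < rotCov f θ := by
  have hD : ∀ t, HasDerivAt (fun t => rotCov f t - Real.cos t * ∫ x, f x ^ 2 ∂γ₁)
      (Real.sin t * (∫ x, f x ^ 2 ∂γ₁ - rotCov f' t)) t := fun t =>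
    ((hasDerivAt_rotCov hf hf' hA hB t).sub ((Real.hasDerivAt_cos t).mul_const _)).congr_deriv
      (by ring)
  have hmono := strictMonoOn_of_deriv_pos (convex_Icc 0 θ)
    (fun t _ => (hD t).continuousAt.continuousWithinAt) fun t ht => by
      rw [interior_Icc] at ht
      have hsin := Real.sin_pos_of_pos_of_lt_pi ht.1 (ht.2.trans hθ')
      rw [(hD t).deriv]
      exact mul_pos hsin (sub_pos.2 ((rotCov_lt hf' hB hy hsin.ne').trans_le hle))
  have h := hmono (Set.left_mem_Icc.2 hθ.le) (Set.right_mem_Icc.2 hθ.le) hθ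
  simp only [rotCov_zero, Real.cos_zero, one_mul, sub_self] at h
  linarith

end Gaussian

section Tanh

variable (b h : ℝ)

lemma hasDerivAt_tanh_affine (x : ℝ) :
    HasDerivAt (fun x => Real.tanh (b * x + h)) (b / Real.cosh (b * x + h) ^ 2) x := by
  have hu : HasDerivAt (fun x => b * x + h) b x := by
    simpa using ((hasDerivAt_id x).const_mul b).add_const h
  have hc := (Real.cosh_pos (b * x + h)).ne'
  simp only [Real.tanh_eq_sinh_div_cosh]
  refine (hu.sinh.div hu.cosh hc).congr_deriv ?_
  congr 1
  linear_combination b * Real.cosh_sq_sub_sinh_sq (b * x + h)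

lemma continuous_tanh_affine : Continuous fun x => Real.tanh (b * x + h) :=
  continuous_iff_continuousAt.2 fun x => (hasDerivAt_tanh_affine b h x).continuousAt

lemma abs_tanh_affine_le (x : ℝ) : |Real.tanh (b * x + h)| ≤ 1 := (Real.abs_tanh_lt_one _).le

lemma continuous_div_cosh_sq_affine : Continuous fun x => b / Real.cosh (b * x + h) ^ 2 :=
  continuous_const.div (by fun_prop) fun _ => (pow_pos (Real.cosh_pos _) 2).ne'

lemma abs_div_cosh_sq_affine_le (x : ℝ) : |b / Real.cosh (b * x + h) ^ 2| ≤ |b| := by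
  rw [abs_div, abs_of_pos (pow_pos (Real.cosh_pos _) 2)]
  exact div_le_self (abs_nonneg _) (one_le_pow₀ (Real.one_le_cosh _))

variable {b h}

lemma tanh_affine_ne (hb : b ≠ 0) :
    Real.tanh (b * 0 + h) ≠ Real.tanh (b * 1 + h) := fun e => by
  have := Real.tanh_injective e
  exact hb (by simpa using this)

lemma div_cosh_sq_affine_ne (hb : b ≠ 0) (hh : h ≠ 0) :
    b / Real.cosh (b * 0 + h) ^ 2 ≠ b / Real.cosh (b * (-h / b) + h) ^ 2 := by
  have h1 := Real.one_lt_cosh.2 hh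
  have h2 : b * (-h / b) + h = 0 := by field_simp; ring
  rw [h2, mul_zero, zero_add, Real.cosh_zero, one_pow, div_one, Ne, div_eq_iff (by positivity)]
  intro e
  have := mul_left_cancel₀ hb ((mul_one b).trans e)
  nlinarith

lemma tanh_add_tanh_nonneg (hh : 0 ≤ h) (x : ℝ) :
    0 ≤ Real.tanh (x + h) + Real.tanh (-x + h) := by
  rw [Real.tanh_eq_sinh_div_cosh, Real.tanh_eq_sinh_div_cosh,
    div_add_div _ _ (Real.cosh_pos _).ne' (Real.cosh_pos _).ne', ← Real.sinh_add]
  exact div_nonneg (Real.sinh_nonneg_iff.2 (by linarith))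
    (mul_pos (Real.cosh_pos _) (Real.cosh_pos _)).le

lemma integral_tanh_affine_nonneg (hh : 0 ≤ h) :
    0 ≤ ∫ x, Real.tanh (b * x + h) ∂(gaussianReal 0 1) := by
  have hI : ∀ c : ℝ, Integrable (fun x => Real.tanh (c * x + h)) γ₁ := fun c =>
    integrable_of_continuous_of_bound (continuous_tanh_affine c h) (abs_tanh_affine_le c h)
  have hneg : ∫ x, Real.tanh (-b * x + h) ∂γ₁ = ∫ x, Real.tanh (b * x + h) ∂γ₁ := by
    have hmap : Measure.map (fun x : ℝ => -x) γ₁ = γ₁ := by simp [gaussianReal_map_neg]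
    conv_rhs => rw [← hmap]
    rw [integral_map (by fun_prop) (continuous_tanh_affine b h).aestronglyMeasurable]
    simp
  have hsum : 0 ≤ ∫ x, (Real.tanh (b * x + h) + Real.tanh (-b * x + h)) ∂γ₁ :=
    integral_nonneg fun x => by simpa using tanh_add_tanh_nonneg hh (b * x)
  rw [integral_add (hI b) (hI (-b)), hneg] at hsum
  linarith

end Tanh

lemma Del_eq_rotCov {β h q t : ℝ} (hq : 0 < q) (ht : 0 ≤ t) (htq : t ≤ q) :
    Del β h q t = rotCov (fun x => Real.tanh (β * √q * x + h)) (Real.arccos (t / q)) := by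
  have hs : 0 ≤ t / q := by positivity
  have hs1 : t / q ≤ 1 := (div_le_one hq).2 htq
  rw [← integral_shared_gaussian (continuous_tanh_affine (β * √q) h)
    (abs_tanh_affine_le (β * √q) h) hs hs1]
  simp only [Del, Gam, abs_of_nonneg hs, Real.sqrt_mul hq.le]
  have hsign : Real.sign (t / q) * √(t / q) = √(t / q) := by
    rcases hs.eq_or_lt with h0 | h0
    · simp [← h0]
    · rw [Real.sign_of_pos h0, one_mul]
  have hcongr : ∀ z z2 : ℝ, β * Real.sign (t / q) * z * (√q * √(t / q))
      + β * z2 * (√q * √(1 - t / q)) + h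
      = β * √q * (√(t / q) * z + √(1 - t / q) * z2) + h := fun z z2 => by
    linear_combination β * z * √q * hsign
  have hcongr' : ∀ z z1 : ℝ, β * z * (√q * √(t / q)) + β * z1 * (√q * √(1 - t / q)) + h
      = β * √q * (√(t / q) * z + √(1 - t / q) * z1) + h := fun z z1 => by ring
  simp only [hcongr, hcongr']

/-- Iterates of a continuous map lying strictly above the diagonal on `[a, b)` increase to `b`. -/
lemma strictMono_and_tendsto_iterate {g : ℝ → ℝ} {a b : ℝ} (ha : 0 ≤ a) (hab : a < b)
    (hg : ContinuousOn g (Set.Icc 0 b)) (hlt : ∀ t, 0 ≤ t → t < b → t < g t)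
    (hgb : ∀ t, 0 ≤ t → t < b → g t < b) :
    StrictMono (fun k : ℕ => g^[k] a) ∧ Tendsto (fun k : ℕ => g^[k] a) atTop (nhds b) := by
  have hmem : ∀ k : ℕ, 0 ≤ g^[k] a ∧ g^[k] a < b := by
    intro k
    induction k with
    | zero => exact ⟨ha, hab⟩
    | succ k ih =>
      rw [Function.iterate_succ_apply']
      exact ⟨ih.1.trans (hlt _ ih.1 ih.2).le, hgb _ ih.1 ih.2⟩
  have hmono : StrictMono (fun k : ℕ => g^[k] a) := by
    refine strictMono_nat_of_lt_succ fun k => ?_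
    rw [Function.iterate_succ_apply']
    exact hlt _ (hmem k).1 (hmem k).2
  refine ⟨hmono, ?_⟩
  have hbdd : BddAbove (Set.range fun k : ℕ => g^[k] a) :=
    ⟨b, Set.forall_mem_range.2 fun k => (hmem k).2.le⟩
  have hlim := tendsto_atTop_ciSup hmono.monotone hbdd
  set L := ⨆ k : ℕ, g^[k] a
  have hL0 : 0 ≤ L := ge_of_tendsto' hlim fun k => (hmem k).1
  have hLb : L ≤ b := le_of_tendsto' hlim fun k => (hmem k).2.le
  have hfix : g L = L := by
    have h1 : Tendsto (fun k : ℕ => g (g^[k] a)) atTop (nhds (g L)) :=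
      (hg L ⟨hL0, hLb⟩).tendsto.comp (tendsto_nhdsWithin_iff.2
        ⟨hlim, Eventually.of_forall fun k => ⟨(hmem k).1, (hmem k).2.le⟩⟩)
    have h2 := hlim.comp (tendsto_add_atTop_nat 1)
    refine tendsto_nhds_unique h1 (h2.congr fun k => ?_)
    simp only [Function.comp_apply, Function.iterate_succ_apply']
  rcases hLb.eq_or_lt with h | h
  · rwa [h] at hlim
  · exact absurd (hlt L hL0 h) (by rw [hfix]; exact lt_irrefl L)

lemma qEq.pos {β h q : ℝ} (hq : qEq β h q) (hh : 0 < h) : 0 < q := by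
  have hq0 : 0 ≤ q := by
    rw [hq]
    exact integral_nonneg fun x => sq_nonneg _
  refine hq0.lt_of_ne fun h0 => ?_
  subst h0
  have h1 : Real.tanh h = 0 := by simpa [qEq] using hq.symm
  exact hh.ne' (Real.tanh_injective (h1.trans Real.tanh_zero.symm))

/-- **Convergence of the iterates of `Δ`** (Section 3.3, (3.13)): inside the AT line,
the sequence `k ↦ Δ^{∘k}(Q(β,h))` is strictly increasing and converges to `q`. -/
theorem Delta_iterates_to_q
    (β h q : ℝ) (hβ : 0 < β) (hh : 0 < h)
    (hq : qEq β h q) (hquniq : ∀ q', qEq β h q' → q' = q)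
    (hAT : β ^ 2 *
        ∫ z, 1 / (Real.cosh (β * z * Real.sqrt q + h)) ^ 4 ∂(gaussianReal 0 1) ≤ 1) :
    StrictMono (fun k : ℕ => (Del β h q)^[k] (Qbh β h q)) ∧
    Tendsto (fun k : ℕ => (Del β h q)^[k] (Qbh β h q)) atTop (nhds q) := by
  have hq0 : 0 < q := hq.pos hh
  set b := β * √q with hb_def
  have hb : b ≠ 0 := (mul_pos hβ (Real.sqrt_pos.2 hq0)).ne'
  have harg : ∀ z : ℝ, β * z * √q + h = b * z + h := fun z => by ring
  simp only [qEq, harg] at hq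
  simp only [harg] at hAT
  set f : ℝ → ℝ := fun x => Real.tanh (b * x + h) with hf_def
  set f' : ℝ → ℝ := fun x => b / Real.cosh (b * x + h) ^ 2 with hf'_def
  have hf : ∀ x, HasDerivAt f (f' x) x := hasDerivAt_tanh_affine b h
  have hf' : Continuous f' := continuous_div_cosh_sq_affine b h
  have hA : ∀ x, |f x| ≤ 1 := abs_tanh_affine_le b h
  have hB : ∀ x, |f' x| ≤ |b| := abs_div_cosh_sq_affine_le b h
  have hle : ∫ x, f' x ^ 2 ∂(gaussianReal 0 1) ≤ ∫ x, f x ^ 2 ∂(gaussianReal 0 1) := by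
    have hsq : ∀ x, f' x ^ 2 = q * β ^ 2 * (1 / Real.cosh (b * x + h) ^ 4) := fun x => by
      simp only [hf'_def, hb_def, div_pow, mul_pow, Real.sq_sqrt hq0.le]
      ring
    simp only [hsq]
    rw [integral_const_mul, ← hq, mul_assoc]
    exact mul_le_of_le_one_right hq0.le hAT
  have hlt : ∀ θ, 0 < θ → θ < Real.pi → Real.cos θ * q < rotCov f θ := fun θ h0 h1 => by
    have := cos_mul_lt_rotCov hf hf' hA hB (div_cosh_sq_affine_ne hb hh.ne') hle h0 h1
    rwa [← hq] at this
  have hgt : ∀ θ, 0 < θ → θ < Real.pi → rotCov f θ < q := fun θ h0 h1 => by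
    have := rotCov_lt (continuous_tanh_affine b h) hA (tanh_affine_ne hb)
      (Real.sin_pos_of_pos_of_lt_pi h0 h1).ne'
    rwa [← hq] at this
  have hE : 0 ≤ ∫ x, f x ∂(gaussianReal 0 1) := integral_tanh_affine_nonneg hh.le
  have hQ : Qbh β h q = √q * ∫ x, f x ∂(gaussianReal 0 1) := by simp only [Qbh, harg, hf_def]
  have hEq : ∫ x, f x ∂(gaussianReal 0 1) < √q := by
    rw [Real.lt_sqrt hE, ← rotCov_pi_div_two]
    exact hgt _ (by positivity) (by linarith [Real.pi_pos])
  have harccos : ∀ t, 0 ≤ t → t < q →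
      0 < Real.arccos (t / q) ∧ Real.arccos (t / q) < Real.pi := fun t h0 h1 => by
    refine ⟨Real.arccos_pos.2 ((div_lt_one hq0).2 h1), ?_⟩
    have := Real.arccos_le_pi_div_two.2 (div_nonneg h0 hq0.le)
    linarith [Real.pi_pos]
  refine strictMono_and_tendsto_iterate ?_ ?_ ?_ ?_ ?_
  · rw [hQ]
    positivity
  · rw [hQ]
    calc √q * ∫ x, f x ∂(gaussianReal 0 1) < √q * √q := by gcongr
      _ = q := Real.mul_self_sqrt hq0.le
  · have hc : Continuous (rotCov f) := continuous_iff_continuousAt.2 fun t =>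
      (hasDerivAt_rotCov hf hf' hA hB t).continuousAt
    have hc' : Continuous fun t => rotCov f (Real.arccos (t / q)) := by fun_prop
    exact hc'.continuousOn.congr fun t ht => Del_eq_rotCov hq0 ht.1 ht.2
  · intro t h0 h1
    rw [Del_eq_rotCov hq0 h0 h1.le]
    have := hlt _ (harccos t h0 h1).1 (harccos t h0 h1).2
    rwa [Real.cos_arccos (by linarith [div_nonneg h0 hq0.le]) ((div_le_one hq0).2 h1.le),
      div_mul_cancel₀ _ hq0.ne'] at this
  · intro t h0 h1
    rw [Del_eq_rotCov hq0 h0 h1.le]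
    exact hgt _ (harccos t h0 h1).1 (harccos t h0 h1).2

end CT
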